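/- Let n ≥ 1 and let f : ℝⁿ → ℝ be a smooth function satisfying the graphical self-shrinker equation ∑_{i,j=1}^n (δ_{ij} − ∂_i f(x) ∂_j f(x)/(1+|∇f(x)|²)) ∂²_{ij} f(x) = (1/2)(x·∇f(x) − f(x)) for every x ∈ ℝⁿ. Then f is linear: there exists a ∈ ℝⁿ such that f(x) = a·x for all x ∈ ℝⁿ (i.e., the entire graphical self-shrinking hypersurface is a plane through the origin). -/

import Mathlib

/-- The `i`-th partial derivative of `f : ℝⁿ → ℝ` at `x`. -/
noncomputable def pd {n : ℕ} (f : EuclideanSpace ℝ (Fin n) → ℝ) (i : Fin n)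
    (x : EuclideanSpace ℝ (Fin n)) : ℝ :=
  fderiv ℝ f x (EuclideanSpace.single i 1)

/-- The second partial derivative `∂²_{ij} f` at `x`. -/
noncomputable def pd2 {n : ℕ} (f : EuclideanSpace ℝ (Fin n) → ℝ) (i j : Fin n)
    (x : EuclideanSpace ℝ (Fin n)) : ℝ :=
  pd (fun y => pd f j y) i x

/-- The inverse induced metric `g^{ij} = δ_{ij} − ∂_i f ∂_j f / (1 + |∇f|²)` of the graph of `f`. -/
noncomputable def gInv {n : ℕ} (f : EuclideanSpace ℝ (Fin n) → ℝ) (i j : Fin n)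
    (x : EuclideanSpace ℝ (Fin n)) : ℝ :=
  (if i = j then 1 else 0) - pd f i x * pd f j x / (1 + ∑ k, (pd f k x) ^ 2)

section PartialDerivatives

variable {n : ℕ} {u w : EuclideanSpace ℝ (Fin n) → ℝ}

theorem pd_eq_of_hasFDerivAt {x : EuclideanSpace ℝ (Fin n)}
    {u' : EuclideanSpace ℝ (Fin n) →L[ℝ] ℝ} (h : HasFDerivAt u u' x) (i : Fin n) :
    pd u i x = u' (EuclideanSpace.single i 1) := by
  rw [pd, h.fderiv]

theorem fderiv_apply_eq_sum_pd (u : EuclideanSpace ℝ (Fin n) → ℝ)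
    (x a : EuclideanSpace ℝ (Fin n)) : fderiv ℝ u x a = ∑ i, a i * pd u i x := by
  have h := (EuclideanSpace.basisFun (Fin n) ℝ).sum_repr a
  conv_lhs => rw [← h]
  simp [pd, map_sum]

theorem ContDiff.pd (hu : ContDiff ℝ (⊤ : ℕ∞) u) (i : Fin n) :
    ContDiff ℝ (⊤ : ℕ∞) (fun x => pd u i x) :=
  (hu.fderiv_right (m := (⊤ : ℕ∞)) (by simp)).clm_apply contDiff_const

theorem pd2_comm (hu : ContDiff ℝ (⊤ : ℕ∞) u) (i j : Fin n) (x : EuclideanSpace ℝ (Fin n)) :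
    pd2 u i j x = pd2 u j i x := by
  have hd : DifferentiableAt ℝ (fderiv ℝ u) x :=
    (hu.fderiv_right (m := (⊤ : ℕ∞)) (by simp)).differentiable (by simp) x
  have key : ∀ a b : Fin n, pd2 u a b x
      = fderiv ℝ (fderiv ℝ u) x (EuclideanSpace.single a 1) (EuclideanSpace.single b 1) := by
    intro a b
    have := hd.hasFDerivAt.clm_apply
      (hasFDerivAt_const (EuclideanSpace.single b (1 : ℝ) : EuclideanSpace ℝ (Fin n)) x)
    rw [pd2]
    unfold pd
    rw [this.fderiv]
    simp
  rw [key, key]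
  have hs : IsSymmSndFDerivAt ℝ u x :=
    (hu.contDiffAt (x := x)).isSymmSndFDerivAt
      (by simpa using WithTop.coe_le_coe.2 (le_top : (2 : ℕ∞) ≤ ⊤))
  exact hs _ _

theorem pd_add {x : EuclideanSpace ℝ (Fin n)} (hu : DifferentiableAt ℝ u x)
    (hw : DifferentiableAt ℝ w x) (i : Fin n) :
    pd (fun y => u y + w y) i x = pd u i x + pd w i x :=
  (pd_eq_of_hasFDerivAt (hu.hasFDerivAt.add hw.hasFDerivAt) i).trans (by simp [pd])

theorem pd_mul {x : EuclideanSpace ℝ (Fin n)} (hu : DifferentiableAt ℝ u x)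
    (hw : DifferentiableAt ℝ w x) (i : Fin n) :
    pd (fun y => u y * w y) i x = pd u i x * w x + u x * pd w i x :=
  (pd_eq_of_hasFDerivAt (hu.hasFDerivAt.mul hw.hasFDerivAt) i).trans (by simp [pd]; ring)

theorem pd_const_mul {x : EuclideanSpace ℝ (Fin n)} (c : ℝ) (hu : DifferentiableAt ℝ u x)
    (i : Fin n) : pd (fun y => c * u y) i x = c * pd u i x :=
  (pd_eq_of_hasFDerivAt (hu.hasFDerivAt.const_mul c) i).trans (by simp [pd])

theorem pd_sum {ι : Type*} (s : Finset ι) {v : ι → EuclideanSpace ℝ (Fin n) → ℝ}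
    {x : EuclideanSpace ℝ (Fin n)} (hv : ∀ k ∈ s, DifferentiableAt ℝ (v k) x) (i : Fin n) :
    pd (fun y => ∑ k ∈ s, v k y) i x = ∑ k ∈ s, pd (v k) i x := by
  rw [pd_eq_of_hasFDerivAt (HasFDerivAt.fun_sum fun k hk => (hv k hk).hasFDerivAt)]
  simp [pd]

theorem pd_comp {φ : ℝ → ℝ} {φ' : ℝ} {x : EuclideanSpace ℝ (Fin n)} (hφ : HasDerivAt φ φ' (u x))
    (hu : DifferentiableAt ℝ u x) (i : Fin n) :
    pd (fun y => φ (u y)) i x = φ' * pd u i x :=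
  (pd_eq_of_hasFDerivAt (hφ.comp_hasFDerivAt x hu.hasFDerivAt) i).trans (by simp [pd])

theorem pd_coord (i j : Fin n) (x : EuclideanSpace ℝ (Fin n)) :
    pd (fun y => y j) i x = if i = j then 1 else 0 :=
  (pd_eq_of_hasFDerivAt (EuclideanSpace.proj (𝕜 := ℝ) j).hasFDerivAt i).trans
    (by simp [eq_comm])

theorem pd2_comp {φ φ' : ℝ → ℝ} {φ'' : ℝ} {x : EuclideanSpace ℝ (Fin n)}
    (hu : ContDiff ℝ (⊤ : ℕ∞) u) (hφ : ∀ y, HasDerivAt φ (φ' (u y)) (u y))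
    (hφ' : HasDerivAt φ' φ'' (u x)) (i j : Fin n) :
    pd2 (fun y => φ (u y)) i j x = φ'' * (pd u i x * pd u j x) + φ' (u x) * pd2 u i j x := by
  have hd : Differentiable ℝ u := hu.differentiable (by simp)
  have h1 : (fun y => pd (fun y => φ (u y)) j y) = fun y => φ' (u y) * pd u j y :=
    funext fun y => pd_comp (hφ y) (hd y) j
  have hφu : DifferentiableAt ℝ (fun y => φ' (u y)) x := hφ'.differentiableAt.comp x (hd x)
  rw [pd2, h1, pd_mul hφu ((hu.pd j).differentiable (by simp) x),
    pd_comp hφ' (hd x), pd2]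
  ring

theorem pd2_add (hu : ContDiff ℝ (⊤ : ℕ∞) u) (hw : ContDiff ℝ (⊤ : ℕ∞) w) (i j : Fin n)
    (x : EuclideanSpace ℝ (Fin n)) :
    pd2 (fun y => u y + w y) i j x = pd2 u i j x + pd2 w i j x := by
  have h1 : (fun y => pd (fun y => u y + w y) j y) = fun y => pd u j y + pd w j y :=
    funext fun y => pd_add (hu.differentiable (by simp) y) (hw.differentiable (by simp) y) j
  rw [pd2, h1, pd_add ((hu.pd j).differentiable (by simp) x)
    ((hw.pd j).differentiable (by simp) x), pd2, pd2]

theorem pd2_const_mul (c : ℝ) (hu : ContDiff ℝ (⊤ : ℕ∞) u) (i j : Fin n)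
    (x : EuclideanSpace ℝ (Fin n)) :
    pd2 (fun y => c * u y) i j x = c * pd2 u i j x := by
  have h1 : (fun y => pd (fun y => c * u y) j y) = fun y => c * pd u j y :=
    funext fun y => pd_const_mul c (hu.differentiable (by simp) y) j
  rw [pd2, h1, pd_const_mul c ((hu.pd j).differentiable (by simp) x), pd2]

theorem pd2_sum {ι : Type*} (s : Finset ι) {v : ι → EuclideanSpace ℝ (Fin n) → ℝ}
    (hv : ∀ k, ContDiff ℝ (⊤ : ℕ∞) (v k)) (i j : Fin n) (x : EuclideanSpace ℝ (Fin n)) :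
    pd2 (fun y => ∑ k ∈ s, v k y) i j x = ∑ k ∈ s, pd2 (v k) i j x := by
  have h1 : (fun y => pd (fun y => ∑ k ∈ s, v k y) j y) = fun y => ∑ k ∈ s, pd (v k) j y :=
    funext fun y => pd_sum s (fun k _ => (hv k).differentiable (by simp) y) j
  rw [pd2, h1, pd_sum s fun k _ => ((hv k).pd j).differentiable (by simp) x]
  rfl

theorem hasDerivAt_comp_line (hu : Differentiable ℝ u) (x a : EuclideanSpace ℝ (Fin n)) (t : ℝ) :
    HasDerivAt (fun s : ℝ => u (x + s • a)) (∑ i, a i * pd u i (x + t • a)) t := by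
  have hl : HasDerivAt (fun s : ℝ => x + s • a) a t := by
    simpa using ((hasDerivAt_id t).smul_const a).const_add x
  rw [← fderiv_apply_eq_sum_pd]
  exact (hu _).hasFDerivAt.comp_hasDerivAt t hl

theorem IsLocalMin.pd_eq_zero {x : EuclideanSpace ℝ (Fin n)} (h : IsLocalMin u x) (i : Fin n) :
    pd u i x = 0 := by
  rw [pd, h.fderiv_eq_zero]
  simp

theorem IsLocalMin.deriv_deriv_nonneg {φ : ℝ → ℝ} {t : ℝ} (h : IsLocalMin φ t)
    (hc : ContinuousAt φ t) : 0 ≤ deriv (deriv φ) t := by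
  by_contra! hneg
  have hmax := isLocalMax_of_deriv_deriv_neg hneg h.deriv_eq_zero hc
  have hconst : φ =ᶠ[nhds t] fun _ => φ t := by
    filter_upwards [h, hmax] with s h1 h2 using le_antisymm h2 h1
  have := hconst.deriv.deriv_eq
  simp at this
  exact hneg.ne this

theorem IsLocalMin.sum_pd2_nonneg {x : EuclideanSpace ℝ (Fin n)} (hu : ContDiff ℝ (⊤ : ℕ∞) u)
    (h : IsLocalMin u x) (a : EuclideanSpace ℝ (Fin n)) :
    0 ≤ ∑ i, ∑ j, pd2 u i j x * (a i * a j) := by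
  have hd : Differentiable ℝ u := hu.differentiable (by simp)
  have hl : ContinuousAt (fun s : ℝ => x + s • a) 0 := by fun_prop
  have hmin : IsLocalMin (fun s : ℝ => u (x + s • a)) 0 := by
    have h0 : IsLocalMin u (x + (0 : ℝ) • a) := by simpa using h
    exact IsMinFilter.comp_tendsto (f := u) (g := fun s : ℝ => x + s • a) h0 hl
  have h1 : deriv (fun s : ℝ => u (x + s • a)) = fun s => ∑ j, a j * pd u j (x + s • a) :=
    funext fun t => (hasDerivAt_comp_line hd x a t).deriv
  have h2 : HasDerivAt (fun s : ℝ => ∑ j, a j * pd u j (x + s • a))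
      (∑ j, a j * ∑ i, a i * pd (fun y => pd u j y) i (x + (0 : ℝ) • a)) 0 :=
    HasDerivAt.fun_sum fun j _ =>
      (hasDerivAt_comp_line ((hu.pd j).differentiable (by simp)) x a 0).const_mul (a j)
  have h3 := hmin.deriv_deriv_nonneg (hasDerivAt_comp_line hd x a 0).continuousAt
  rw [h1, h2.deriv] at h3
  rw [Finset.sum_comm]
  convert h3 using 2 with j
  rw [Finset.mul_sum]
  refine Finset.sum_congr rfl fun i _ => ?_
  simp only [pd2, zero_smul, add_zero]
  ring

end PartialDerivatives

section DriftLaplacian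

variable {n : ℕ} {f u w : EuclideanSpace ℝ (Fin n) → ℝ} {x : EuclideanSpace ℝ (Fin n)}

/-- The squared length `|∇f|²` of the gradient. -/
noncomputable def gradSq (f : EuclideanSpace ℝ (Fin n) → ℝ) (x : EuclideanSpace ℝ (Fin n)) : ℝ :=
  ∑ k, pd f k x ^ 2

/-- The drift Laplacian `g^{ij} ∂²_{ij} u − ½ x·∇u` of the graph of `f`. -/
noncomputable def driftLap (f u : EuclideanSpace ℝ (Fin n) → ℝ) (x : EuclideanSpace ℝ (Fin n)) :
    ℝ :=
  ∑ i, ∑ j, gInv f i j x * pd2 u i j x - 1 / 2 * ∑ i, x i * pd u i x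

/-- The squared length `g^{ij} ∂_i u ∂_j u` of the gradient of `u` along the graph of `f`. -/
noncomputable def graphGradSq (f u : EuclideanSpace ℝ (Fin n) → ℝ)
    (x : EuclideanSpace ℝ (Fin n)) : ℝ :=
  ∑ i, ∑ j, gInv f i j x * (pd u i x * pd u j x)

theorem gradSq_nonneg : 0 ≤ gradSq f x :=
  Finset.sum_nonneg fun _ _ => sq_nonneg _

theorem sum_gInv_mul (M : Fin n → Fin n → ℝ) :
    ∑ i, ∑ j, gInv f i j x * M i j
      = ∑ i, M i i - (∑ i, ∑ j, pd f i x * pd f j x * M i j) / (1 + gradSq f x) := by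
  simp only [gInv, sub_mul, Finset.sum_sub_distrib, ite_mul, one_mul, zero_mul,
    Finset.sum_ite_eq, Finset.mem_univ, if_true, Finset.sum_div, gradSq]
  congr 1
  exact Finset.sum_congr rfl fun i _ => Finset.sum_congr rfl fun j _ => by ring

theorem sum_sum_mul_le_of_nonneg {ι : Type*} [Fintype ι] {M : ι → ι → ℝ}
    (hM : ∀ a : ι → ℝ, 0 ≤ ∑ i, ∑ j, M i j * (a i * a j)) (p : ι → ℝ) :
    ∑ i, ∑ j, p i * p j * M i j ≤ (∑ i, p i ^ 2) * ∑ i, M i i := by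
  classical
  have key : ∀ m l, 0 ≤ p l ^ 2 * M m m - p m * p l * M m l - p l * p m * M l m
      + p m ^ 2 * M l l := by
    intro m l
    have h := hM (fun i => p l * (if i = m then 1 else 0) - p m * (if i = l then 1 else 0))
    convert h using 1
    simp only [mul_sub, sub_mul, Finset.sum_sub_distrib, mul_ite, ite_mul, mul_one, mul_zero,
      zero_mul, Finset.sum_ite_eq', Finset.mem_univ, if_true]
    ring
  have hsum := Finset.sum_nonneg fun m (_ : m ∈ Finset.univ) =>
    Finset.sum_nonneg fun l (_ : l ∈ Finset.univ) => key m l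
  simp only [Finset.sum_add_distrib, Finset.sum_sub_distrib] at hsum
  have h1 : ∑ m, ∑ l, p l ^ 2 * M m m = (∑ i, p i ^ 2) * ∑ i, M i i := by
    rw [Finset.sum_mul_sum, Finset.sum_comm]
  have h2 : ∑ m, ∑ l, p m ^ 2 * M l l = (∑ i, p i ^ 2) * ∑ i, M i i := by
    rw [Finset.sum_mul_sum]
  have h3 : ∑ m, ∑ l, p l * p m * M l m = ∑ i, ∑ j, p i * p j * M i j := Finset.sum_comm
  linarith

theorem sum_gInv_mul_nonneg {M : Fin n → Fin n → ℝ}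
    (hM : ∀ a : Fin n → ℝ, 0 ≤ ∑ i, ∑ j, M i j * (a i * a j)) :
    0 ≤ ∑ i, ∑ j, gInv f i j x * M i j := by
  have htr : 0 ≤ ∑ i, M i i := Finset.sum_nonneg fun m _ => by
    simpa using hM (fun i => if i = m then 1 else 0)
  have h := sum_sum_mul_le_of_nonneg hM fun i => pd f i x
  have hq : 0 ≤ gradSq f x := gradSq_nonneg
  rw [sum_gInv_mul, sub_nonneg, div_le_iff₀ (by linarith)]
  change _ ≤ gradSq f x * _ at h
  linarith

theorem sum_gInv_mul_le_sum {M : Fin n → Fin n → ℝ}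
    (hM : ∀ a : Fin n → ℝ, 0 ≤ ∑ i, ∑ j, M i j * (a i * a j)) :
    ∑ i, ∑ j, gInv f i j x * M i j ≤ ∑ i, M i i := by
  rw [sum_gInv_mul]
  have h : ∑ i, ∑ j, pd f i x * pd f j x * M i j = ∑ i, ∑ j, M i j * (pd f i x * pd f j x) :=
    Finset.sum_congr rfl fun i _ => Finset.sum_congr rfl fun j _ => mul_comm _ _
  have hq : 0 ≤ gradSq f x := gradSq_nonneg
  linarith [div_nonneg (h ▸ hM fun i => pd f i x) (by linarith : 0 ≤ 1 + gradSq f x)]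

theorem sum_sq_div_le_graphGradSq :
    (∑ i, pd u i x ^ 2) / (1 + gradSq f x) ≤ graphGradSq f u x := by
  have hq : 0 ≤ gradSq f x := gradSq_nonneg
  have hcs := Finset.sum_mul_sq_le_sq_mul_sq Finset.univ (fun i => pd f i x) fun i => pd u i x
  have hsq : ∑ i, ∑ j, pd f i x * pd f j x * (pd u i x * pd u j x)
      = (∑ i, pd f i x * pd u i x) ^ 2 := by
    rw [sq, Finset.sum_mul_sum]
    exact Finset.sum_congr rfl fun i _ => Finset.sum_congr rfl fun j _ => by ring
  rw [graphGradSq, sum_gInv_mul, hsq, le_sub_iff_add_le, ← add_div,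
    div_le_iff₀ (by linarith)]
  simp only [← sq]
  change _ ≤ gradSq f x * _ at hcs
  linarith

theorem driftLap_comp {φ φ' : ℝ → ℝ} {φ'' : ℝ} (hu : ContDiff ℝ (⊤ : ℕ∞) u)
    (hφ : ∀ y, HasDerivAt φ (φ' (u y)) (u y)) (hφ' : HasDerivAt φ' φ'' (u x)) :
    driftLap f (fun y => φ (u y)) x
      = φ'' * graphGradSq f u x + φ' (u x) * driftLap f u x := by
  have h1 : ∀ i, pd (fun y => φ (u y)) i x = φ' (u x) * pd u i x := fun i =>
    pd_comp (hφ x) (hu.differentiable (by simp) x) i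
  simp only [driftLap, graphGradSq, pd2_comp hu hφ hφ', h1, mul_sub, mul_add, Finset.mul_sum,
    Finset.sum_add_distrib]
  rw [add_sub_assoc]
  congr 1
  · exact Finset.sum_congr rfl fun i _ => Finset.sum_congr rfl fun j _ => by ring
  congr 1
  · exact Finset.sum_congr rfl fun i _ => Finset.sum_congr rfl fun j _ => by ring
  · exact Finset.sum_congr rfl fun i _ => by ring

theorem driftLap_add (hu : ContDiff ℝ (⊤ : ℕ∞) u) (hw : ContDiff ℝ (⊤ : ℕ∞) w) :
    driftLap f (fun y => u y + w y) x = driftLap f u x + driftLap f w x := by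
  have h1 : ∀ i, pd (fun y => u y + w y) i x = pd u i x + pd w i x := fun i =>
    pd_add (hu.differentiable (by simp) x) (hw.differentiable (by simp) x) i
  simp only [driftLap, pd2_add hu hw, h1, mul_add, Finset.sum_add_distrib]
  ring

theorem driftLap_const_mul (c : ℝ) (hu : ContDiff ℝ (⊤ : ℕ∞) u) :
    driftLap f (fun y => c * u y) x = c * driftLap f u x := by
  have h1 : ∀ i, pd (fun y => c * u y) i x = c * pd u i x := fun i =>
    pd_const_mul c (hu.differentiable (by simp) x) i
  simp only [driftLap, pd2_const_mul c hu, h1, mul_sub, Finset.mul_sum]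
  congr 1
  · exact Finset.sum_congr rfl fun i _ => Finset.sum_congr rfl fun j _ => by ring
  · exact Finset.sum_congr rfl fun i _ => by ring

theorem driftLap_sum {ι : Type*} (s : Finset ι) {v : ι → EuclideanSpace ℝ (Fin n) → ℝ}
    (hv : ∀ k, ContDiff ℝ (⊤ : ℕ∞) (v k)) :
    driftLap f (fun y => ∑ k ∈ s, v k y) x = ∑ k ∈ s, driftLap f (v k) x := by
  have h1 : ∀ i, pd (fun y => ∑ k ∈ s, v k y) i x = ∑ k ∈ s, pd (v k) i x := fun i =>
    pd_sum s (fun k _ => (hv k).differentiable (by simp) x) i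
  simp only [driftLap, pd2_sum s hv, h1, Finset.sum_sub_distrib, Finset.mul_sum]
  congr 1
  · rw [Finset.sum_comm (s := s)]
    exact Finset.sum_congr rfl fun i _ => Finset.sum_comm
  · rw [Finset.sum_comm]

theorem IsLocalMin.driftLap_nonneg (hu : ContDiff ℝ (⊤ : ℕ∞) u) (h : IsLocalMin u x) :
    0 ≤ driftLap f u x := by
  have h1 : ∀ i, pd u i x = 0 := h.pd_eq_zero
  simp only [driftLap, h1, mul_zero, Finset.sum_const_zero, sub_zero]
  exact sum_gInv_mul_nonneg fun a => h.sum_pd2_nonneg hu (WithLp.toLp 2 a)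

theorem ContDiff.gradSq (hf : ContDiff ℝ (⊤ : ℕ∞) f) : ContDiff ℝ (⊤ : ℕ∞) (gradSq f) :=
  ContDiff.sum fun k _ => (hf.pd k).pow 2

theorem pd_gradSq (hf : ContDiff ℝ (⊤ : ℕ∞) f) (i : Fin n) :
    pd (gradSq f) i x = 2 * ∑ k, pd f k x * pd2 f i k x := by
  have hd : ∀ k, DifferentiableAt ℝ (fun y => pd f k y) x := fun k =>
    (hf.pd k).differentiable (by simp) x
  refine (pd_sum Finset.univ (v := fun k y => pd f k y ^ 2) (fun k _ => (hd k).pow 2) i).trans ?_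
  rw [Finset.mul_sum]
  refine Finset.sum_congr rfl fun k _ => ?_
  refine (pd_comp (φ := fun t => t ^ 2) (hasDerivAt_pow 2 _) (hd k) i).trans ?_
  simp only [pd2]
  ring

end DriftLaplacian

section SelfShrinker

variable {n : ℕ} {f : EuclideanSpace ℝ (Fin n) → ℝ}

theorem pd_pd2 (hf : ContDiff ℝ (⊤ : ℕ∞) f) (i j k : Fin n) (x : EuclideanSpace ℝ (Fin n)) :
    pd (fun y => pd2 f i j y) k x = pd2 (fun y => pd f k y) i j x := by
  have h1 : pd (fun y => pd2 f i j y) k x = pd2 (fun y => pd f j y) k i x := rfl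
  have h2 : (fun y => pd (fun z => pd f j z) k y) = fun y => pd (fun z => pd f k z) j y :=
    funext fun y => pd2_comm hf k j y
  rw [h1, pd2_comm (hf.pd j), pd2, h2, pd2]

/-- Differentiating the self-shrinker equation in the direction `k`. -/
theorem driftLap_pd (hf : ContDiff ℝ (⊤ : ℕ∞) f)
    (heq : ∀ x, ∑ i, ∑ j, gInv f i j x * pd2 f i j x
      = (1 / 2) * ((∑ i, x i * pd f i x) - f x))
    (k : Fin n) (x : EuclideanSpace ℝ (Fin n)) :
    driftLap f (fun y => pd f k y) x
      = (1 + gradSq f x)⁻¹ * ∑ i, ∑ j, gInv f i j x * (pd (gradSq f) i x * pd2 f j k x) := by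
  have hq : ∀ y, 1 + gradSq f y ≠ 0 := fun y => by
    have : 0 ≤ gradSq f y := gradSq_nonneg
    linarith
  have d0 : Differentiable ℝ f := hf.differentiable (by simp)
  have d1 : ∀ i, Differentiable ℝ (fun y => pd f i y) := fun i =>
    (hf.pd i).differentiable (by simp)
  have d2 : ∀ i j, Differentiable ℝ (fun y => pd2 f i j y) := fun i j =>
    ((hf.pd j).pd i).differentiable (by simp)
  have dq : Differentiable ℝ (gradSq f) := hf.gradSq.differentiable (by simp)
  have dc : ∀ i, Differentiable ℝ fun y : EuclideanSpace ℝ (Fin n) => y i := fun i => by fun_prop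
  have dR : Differentiable ℝ fun y => ∑ i, y i * pd f i y :=
    Differentiable.fun_sum fun i _ => (dc i).mul (d1 i)
  have dT : Differentiable ℝ fun y => ∑ i, pd2 f i i y := Differentiable.fun_sum fun i _ => d2 i i
  have cleared : (fun y => ∑ i, ∑ j, pd f i y * pd f j y * pd2 f i j y)
      = fun y => (1 + gradSq f y) *
        (∑ i, pd2 f i i y + -(1 / 2) * (∑ i, y i * pd f i y + -1 * f y)) := by
    funext y
    have h := heq y
    rw [sum_gInv_mul] at h
    have := hq y
    field_simp at h ⊢
    linarith
  have hB := congrFun cleared x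
  have hD := congrArg (fun u => pd u k x) cleared
  simp only at hB hD
  have dL : Differentiable ℝ fun y => ∑ i, y i * pd f i y + -1 * f y := dR.add (d0.const_mul _)
  have dS : Differentiable ℝ fun y =>
      ∑ i, pd2 f i i y + -(1 / 2) * (∑ i, y i * pd f i y + -1 * f y) := dT.add (dL.const_mul _)
  have hN : pd (fun y => ∑ i, ∑ j, pd f i y * pd f j y * pd2 f i j y) k x
      = ∑ i, ∑ j, pd2 f k i x * pd f j x * pd2 f i j x
        + ∑ i, ∑ j, pd f i x * pd2 f k j x * pd2 f i j x
        + ∑ i, ∑ j, pd f i x * pd f j x * pd2 (fun y => pd f k y) i j x := by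
    rw [pd_sum _ fun i _ =>
      (Differentiable.fun_sum fun j _ => ((d1 i).fun_mul (d1 j)).fun_mul (d2 i j)) x]
    simp only [← Finset.sum_add_distrib]
    refine Finset.sum_congr rfl fun i _ => ?_
    rw [pd_sum _ fun j _ => (((d1 i).fun_mul (d1 j)).fun_mul (d2 i j)) x]
    refine Finset.sum_congr rfl fun j _ => ?_
    rw [pd_mul (((d1 i).fun_mul (d1 j)) x) (d2 i j x), pd_mul (d1 i x) (d1 j x), pd_pd2 hf]
    simp only [pd2]
    ring
  have hT : pd (fun y => ∑ i, pd2 f i i y) k x = ∑ i, pd2 (fun y => pd f k y) i i x := by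
    rw [pd_sum _ fun i _ => d2 i i x]
    exact Finset.sum_congr rfl fun i _ => pd_pd2 hf i i k x
  have hR : pd (fun y => ∑ i, y i * pd f i y) k x = pd f k x + ∑ i, x i * pd2 f i k x := by
    rw [pd_sum _ fun i _ => ((dc i).fun_mul (d1 i)) x]
    simp only [pd_mul (dc _ x) (d1 _ x), pd_coord, Finset.sum_add_distrib, ite_mul, one_mul,
      zero_mul, Finset.sum_ite_eq, Finset.mem_univ, if_true]
    congr 1
    exact Finset.sum_congr rfl fun i _ => by rw [pd2_comm hf i k, pd2]
  have h1q : pd (fun y => 1 + gradSq f y) k x = pd (gradSq f) k x :=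
    (pd_eq_of_hasFDerivAt ((dq x).hasFDerivAt.const_add 1) k).trans rfl
  rw [hN, pd_mul ((dq.const_add 1) x) (dS x), h1q, pd_add (dT x) ((dL.const_mul _) x),
    pd_const_mul _ (dL x), pd_add (dR x) ((d0.const_mul _) x), pd_const_mul _ (d0 x), hT, hR] at hD
  have e1 : ∑ i, ∑ j, pd2 f k i x * pd f j x * pd2 f i j x
      = 1 / 2 * ∑ i, pd (gradSq f) i x * pd2 f i k x := by
    simp only [pd_gradSq hf, Finset.mul_sum, Finset.sum_mul]
    exact Finset.sum_congr rfl fun i _ => Finset.sum_congr rfl fun j _ => by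
      rw [pd2_comm hf k i]; ring
  have e2 : ∑ i, ∑ j, pd f i x * pd2 f k j x * pd2 f i j x
      = 1 / 2 * ∑ i, pd (gradSq f) i x * pd2 f i k x := by
    simp only [pd_gradSq hf, Finset.mul_sum, Finset.sum_mul]
    rw [Finset.sum_comm]
    exact Finset.sum_congr rfl fun i _ => Finset.sum_congr rfl fun j _ => by
      rw [pd2_comm hf k i, pd2_comm hf j i]; ring
  have e3 : ∑ i, ∑ j, pd f i x * pd f j x * (pd (gradSq f) i x * pd2 f j k x)
      = (∑ i, ∑ j, pd f i x * pd f j x * pd2 f i j x) * pd (gradSq f) k x := by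
    have : ∑ i, ∑ j, pd f i x * pd f j x * (pd (gradSq f) i x * pd2 f j k x)
        = (∑ i, pd f i x * pd (gradSq f) i x) * ∑ j, pd f j x * pd2 f k j x := by
      rw [Finset.sum_mul_sum]
      exact Finset.sum_congr rfl fun i _ => Finset.sum_congr rfl fun j _ => by
        rw [pd2_comm hf j k]; ring
    rw [this, pd_gradSq hf k]
    have : ∑ i, pd f i x * pd (gradSq f) i x
        = 2 * ∑ i, ∑ j, pd f i x * pd f j x * pd2 f i j x := by
      simp only [pd_gradSq hf, Finset.mul_sum]
      exact Finset.sum_congr rfl fun i _ => Finset.sum_congr rfl fun j _ => by ring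
    rw [this]
    ring
  have e4 : ∀ i, pd (fun y => pd f k y) i x = pd2 f i k x := fun _ => rfl
  have hB' : ∑ i, pd2 f i i x + -(1 / 2) * (∑ i, x i * pd f i x + -1 * f x)
      = (∑ i, ∑ j, pd f i x * pd f j x * pd2 f i j x) / (1 + gradSq f x) := by
    rw [eq_div_iff (hq x), hB, mul_comm]
  rw [hB', e1, e2] at hD
  simp only [driftLap, sum_gInv_mul, e3, e4]
  have := hq x
  field_simp at hD ⊢
  linarith

theorem driftLap_gradSq (hf : ContDiff ℝ (⊤ : ℕ∞) f)
    (heq : ∀ x, ∑ i, ∑ j, gInv f i j x * pd2 f i j x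
      = (1 / 2) * ((∑ i, x i * pd f i x) - f x))
    (x : EuclideanSpace ℝ (Fin n)) :
    driftLap f (gradSq f) x
      = 2 * ∑ k, graphGradSq f (fun y => pd f k y) x
        + (1 + gradSq f x)⁻¹ * graphGradSq f (gradSq f) x := by
  have h1 : ∀ k, driftLap f (fun y => pd f k y ^ 2) x
      = 2 * graphGradSq f (fun y => pd f k y) x
        + 2 * pd f k x * driftLap f (fun y => pd f k y) x := fun k =>
    driftLap_comp (φ := fun t => t ^ 2) (φ' := fun t => 2 * t) (hf.pd k)
      (fun y => by simpa using hasDerivAt_pow 2 (pd f k y))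
      (by simpa using (hasDerivAt_id (pd f k x)).const_mul 2)
  refine (driftLap_sum Finset.univ fun k => (hf.pd k).pow 2).trans ?_
  simp only [h1, Finset.sum_add_distrib, ← Finset.mul_sum]
  congr 1
  simp only [driftLap_pd hf heq, graphGradSq, Finset.mul_sum]
  rw [Finset.sum_comm]
  refine Finset.sum_congr rfl fun i _ => ?_
  rw [Finset.sum_comm]
  refine Finset.sum_congr rfl fun j _ => ?_
  rw [pd_gradSq hf j]
  simp only [Finset.mul_sum]
  exact Finset.sum_congr rfl fun k _ => by ring

theorem graphGradSq_gradSq_le (hf : ContDiff ℝ (⊤ : ℕ∞) f) (x : EuclideanSpace ℝ (Fin n)) :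
    graphGradSq f (gradSq f) x
      ≤ 4 * (1 + gradSq f x) * ∑ k, graphGradSq f (fun y => pd f k y) x := by
  have key := sum_gInv_mul_nonneg (f := f) (x := x) (M := fun i j =>
    4 * (1 + gradSq f x) * ∑ k, pd2 f i k x * pd2 f j k x
      - pd (gradSq f) i x * pd (gradSq f) j x) ?_
  · have e : 4 * (1 + gradSq f x) * ∑ k, graphGradSq f (fun y => pd f k y) x
        = ∑ i, ∑ j, gInv f i j x * (4 * (1 + gradSq f x) * ∑ k, pd2 f i k x * pd2 f j k x) := by
      simp only [graphGradSq, Finset.mul_sum]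
      rw [Finset.sum_comm]
      refine Finset.sum_congr rfl fun i _ => ?_
      rw [Finset.sum_comm]
      refine Finset.sum_congr rfl fun j _ => Finset.sum_congr rfl fun k _ => ?_
      simp only [pd2]
      ring
    simp only [mul_sub, Finset.sum_sub_distrib] at key
    rw [e]
    exact sub_nonneg.1 key
  · intro a
    have e1 : ∑ i, ∑ j, (∑ k, pd2 f i k x * pd2 f j k x) * (a i * a j)
        = ∑ k, (∑ i, a i * pd2 f i k x) ^ 2 := by
      simp only [sq, Finset.sum_mul_sum]
      conv_rhs => rw [Finset.sum_comm]
      refine Finset.sum_congr rfl fun i _ => ?_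
      conv_rhs => rw [Finset.sum_comm]
      refine Finset.sum_congr rfl fun j _ => ?_
      rw [Finset.sum_mul]
      exact Finset.sum_congr rfl fun k _ => by ring
    have e2 : ∑ i, ∑ j, pd (gradSq f) i x * pd (gradSq f) j x * (a i * a j)
        = 4 * (∑ k, pd f k x * ∑ i, a i * pd2 f i k x) ^ 2 := by
      have : ∑ k, pd f k x * ∑ i, a i * pd2 f i k x = 1 / 2 * ∑ i, a i * pd (gradSq f) i x := by
        simp only [pd_gradSq hf, Finset.mul_sum]
        rw [Finset.sum_comm]
        exact Finset.sum_congr rfl fun i _ => Finset.sum_congr rfl fun j _ => by ring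
      rw [this, mul_pow, sq (∑ i, a i * pd (gradSq f) i x), Finset.sum_mul_sum]
      simp only [Finset.mul_sum]
      exact Finset.sum_congr rfl fun i _ => Finset.sum_congr rfl fun j _ => by ring
    have hcs := Finset.sum_mul_sq_le_sq_mul_sq Finset.univ (fun k => pd f k x)
      fun k => ∑ i, a i * pd2 f i k x
    change _ ≤ gradSq f x * _ at hcs
    have hnn : 0 ≤ ∑ k, (∑ i, a i * pd2 f i k x) ^ 2 := Finset.sum_nonneg fun _ _ => sq_nonneg _
    simp only [sub_mul, Finset.sum_sub_distrib, mul_assoc (4 * (1 + gradSq f x)),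
      ← Finset.mul_sum]
    rw [e1, e2]
    linarith

/-- The reciprocal `(1 + |∇f|²)^(-1/2)` of the volume element is a supersolution. -/
theorem driftLap_rpow_gradSq_nonpos (hf : ContDiff ℝ (⊤ : ℕ∞) f)
    (heq : ∀ x, ∑ i, ∑ j, gInv f i j x * pd2 f i j x
      = (1 / 2) * ((∑ i, x i * pd f i x) - f x))
    (x : EuclideanSpace ℝ (Fin n)) :
    driftLap f (fun y => (1 + gradSq f y) ^ (-1 / 2 : ℝ)) x ≤ 0 := by
  have hpos : ∀ y, 0 < 1 + gradSq f y := fun y => by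
    have : 0 ≤ gradSq f y := gradSq_nonneg
    linarith
  have hder : ∀ (r : ℝ) (y : EuclideanSpace ℝ (Fin n)), HasDerivAt (fun t : ℝ => (1 + t) ^ r)
      (r * (1 + gradSq f y) ^ (r - 1)) (gradSq f y) := fun r y => by
    simpa using ((hasDerivAt_id (gradSq f y)).const_add 1).rpow_const (p := r)
      (Or.inl (hpos y).ne')
  rw [driftLap_comp (φ := fun t => (1 + t) ^ (-1 / 2 : ℝ))
    (φ' := fun t => (-1 / 2) * (1 + t) ^ (-1 / 2 - 1 : ℝ)) hf.gradSq
    (fun y => hder _ y) ((hder _ x).const_mul _), driftLap_gradSq hf heq]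
  have hz : (1 + gradSq f x) ^ (-1 / 2 - 1 : ℝ)
      = (1 + gradSq f x) ^ (-1 / 2 - 1 - 1 : ℝ) * (1 + gradSq f x) := by
    conv_rhs => rw [← Real.rpow_add_one (hpos x).ne']
    norm_num
  rw [hz]
  have hle := graphGradSq_gradSq_le hf x
  have hzp : 0 < (1 + gradSq f x) ^ (-1 / 2 - 1 - 1 : ℝ) := Real.rpow_pos_of_pos (hpos x) _
  have hne := (hpos x).ne'
  set z := (1 + gradSq f x) ^ (-1 / 2 - 1 - 1 : ℝ)
  set A := ∑ k, graphGradSq f (fun y => pd f k y) x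
  set B := graphGradSq f (gradSq f) x
  have : -1 / 2 * ((-1 / 2 - 1) * z) * B
      + -1 / 2 * (z * (1 + gradSq f x)) * (2 * A + (1 + gradSq f x)⁻¹ * B)
      = -(z / 4) * (4 * (1 + gradSq f x) * A - B) := by
    field_simp
    ring
  rw [this]
  nlinarith

theorem contDiff_sum_sq_sub (p : EuclideanSpace ℝ (Fin n)) :
    ContDiff ℝ (⊤ : ℕ∞) fun y : EuclideanSpace ℝ (Fin n) => ∑ i, (y i - p i) ^ 2 := by
  fun_prop

theorem pd_sum_sq_sub (p : EuclideanSpace ℝ (Fin n)) (i : Fin n) (x : EuclideanSpace ℝ (Fin n)) :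
    pd (fun y => ∑ k, (y k - p k) ^ 2) i x = 2 * (x i - p i) := by
  have dc : ∀ k, DifferentiableAt ℝ (fun y : EuclideanSpace ℝ (Fin n) => y k) x := fun k => by
    fun_prop
  have h : ∀ k, pd (fun y => (y k - p k) ^ 2) i x = 2 * (x k - p k) * if i = k then 1 else 0 := by
    intro k
    have hd : ∀ c t : ℝ, HasDerivAt (fun t => (t - c) ^ 2) (2 * (t - c)) t := fun c t => by
      simpa using ((hasDerivAt_id t).sub_const c).fun_pow 2
    have := pd_comp (hd (p k) (x k)) (dc k) i
    rwa [pd_coord] at this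
  rw [pd_sum _ fun k _ => by fun_prop]
  simp [h]

theorem pd2_sum_sq_sub (p : EuclideanSpace ℝ (Fin n)) (i j : Fin n)
    (x : EuclideanSpace ℝ (Fin n)) :
    pd2 (fun y => ∑ k, (y k - p k) ^ 2) i j x = if i = j then 2 else 0 := by
  have h : (fun y => pd (fun y => ∑ k, (y k - p k) ^ 2) j y) = fun y => 2 * (y j - p j) :=
    funext fun y => pd_sum_sq_sub p j y
  have := pd_comp (φ := fun t => 2 * (t - p j)) (φ' := 2)
    (by simpa using ((hasDerivAt_id (x j)).sub_const (p j)).const_mul 2)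
    (by fun_prop : DifferentiableAt ℝ (fun y : EuclideanSpace ℝ (Fin n) => y j) x) i
  rw [pd2, h, this, pd_coord]
  simp

theorem driftLap_sum_sq_sub_le (p x : EuclideanSpace ℝ (Fin n)) :
    driftLap f (fun y => ∑ k, (y k - p k) ^ 2) x
      ≤ (4 * n + ∑ i, p i ^ 2 - ∑ k, (x k - p k) ^ 2) / 2 := by
  have h1 : ∑ i, ∑ j, gInv f i j x * (if i = j then 2 else 0) ≤ 2 * n := by
    refine (sum_gInv_mul_le_sum fun a => Finset.sum_nonneg fun i _ =>
      Finset.sum_nonneg fun j _ => ?_).trans_eq (by simp [mul_comm])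
    split_ifs with h
    · subst h
      nlinarith [mul_self_nonneg (a i)]
    · simp
  have h2 : (∑ k, (x k - p k) ^ 2 - ∑ i, p i ^ 2) / 2 ≤ 1 / 2 * ∑ i, x i * (2 * (x i - p i)) := by
    rw [← Finset.sum_sub_distrib, Finset.sum_div, Finset.mul_sum]
    exact Finset.sum_le_sum fun i _ => by nlinarith [sq_nonneg (x i)]
  simp only [driftLap, pd_sum_sq_sub, pd2_sum_sq_sub]
  linarith

theorem graphGradSq_sum_sq_sub_ge (p x : EuclideanSpace ℝ (Fin n)) :
    4 * (∑ k, (x k - p k) ^ 2) / (1 + gradSq f x)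
      ≤ graphGradSq f (fun y => ∑ k, (y k - p k) ^ 2) x := by
  refine le_trans (le_of_eq ?_) sum_sq_div_le_graphGradSq
  simp only [pd_sum_sq_sub, mul_pow, ← Finset.mul_sum]
  norm_num

theorem sum_sq_sub_eq_dist_sq (p x : EuclideanSpace ℝ (Fin n)) :
    ∑ k, (x k - p k) ^ 2 = dist x p ^ 2 := by
  rw [dist_eq_norm, EuclideanSpace.real_norm_sq_eq]
  simp

theorem tendsto_sum_sq_sub (p : EuclideanSpace ℝ (Fin n)) :
    Filter.Tendsto (fun x : EuclideanSpace ℝ (Fin n) => ∑ k, (x k - p k) ^ 2)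
      (Filter.cocompact _) Filter.atTop := by
  simp only [sum_sq_sub_eq_dist_sq]
  exact (Filter.tendsto_pow_atTop two_ne_zero).comp (tendsto_dist_right_cocompact_atTop p)

theorem exists_barrier (hf : ContDiff ℝ (⊤ : ℕ∞) f) (p : EuclideanSpace ℝ (Fin n)) {r : ℝ}
    (hr : 0 < r) :
    ∃ ψ : EuclideanSpace ℝ (Fin n) → ℝ, ContDiff ℝ (⊤ : ℕ∞) ψ ∧ (∀ x, -1 ≤ ψ x) ∧
      Filter.Tendsto ψ (Filter.cocompact _) Filter.atTop ∧
      ∀ x, r ≤ dist x p ^ 2 → driftLap f ψ x < 0 := by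
  obtain ⟨C, hC⟩ : ∃ C : ℝ, C = 4 * n + ∑ i, p i ^ 2 + 1 := ⟨_, rfl⟩
  have hCpos : 0 < C := by
    have : 0 ≤ ∑ i, p i ^ 2 := Finset.sum_nonneg fun _ _ => sq_nonneg _
    rw [hC]
    positivity
  obtain ⟨Q, hQ⟩ := (isCompact_closedBall p √C).bddAbove_image
    hf.gradSq.continuous.continuousOn
  have hQ' : ∀ x, dist x p ^ 2 ≤ C → gradSq f x ≤ Q := fun x hx =>
    hQ (Set.mem_image_of_mem _ (Metric.mem_closedBall.2 (Real.le_sqrt_of_sq_le hx)))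
  have hQpos : 0 < 1 + Q := by
    have h0 : 0 ≤ gradSq f p := gradSq_nonneg
    have := hQ' p (by simpa using hCpos.le)
    linarith
  obtain ⟨α, hα⟩ : ∃ α : ℝ, α = C * (1 + Q) / (4 * r) := ⟨_, rfl⟩
  have hαpos : 0 < α := by rw [hα]; positivity
  obtain ⟨δ, hδ⟩ : ∃ δ : ℝ, δ = α * Real.exp (-α * C) / 2 := ⟨_, rfl⟩
  have hδpos : 0 < δ := by rw [hδ]; positivity
  have hs := contDiff_sum_sq_sub p
  have hs0 : ∀ x : EuclideanSpace ℝ (Fin n), 0 ≤ ∑ k, (x k - p k) ^ 2 := fun x =>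
    Finset.sum_nonneg fun _ _ => sq_nonneg _
  have hexp : ∀ x : EuclideanSpace ℝ (Fin n),
      Real.exp (-α * ∑ k, (x k - p k) ^ 2) ≤ 1 := fun x =>
    Real.exp_le_one_iff.2 (by nlinarith [hs0 x])
  have hder : ∀ t : ℝ, HasDerivAt (fun t => Real.exp (-α * t)) (Real.exp (-α * t) * -α) t :=
    fun t => by simpa using ((hasDerivAt_id t).const_mul (-α)).exp
  refine ⟨fun x => -Real.exp (-α * ∑ k, (x k - p k) ^ 2) + δ * ∑ k, (x k - p k) ^ 2,
    by fun_prop, fun x => ?_, ?_, fun x hx => ?_⟩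
  · have := mul_nonneg hδpos.le (hs0 x)
    linarith [hexp x]
  · exact Filter.tendsto_atTop_add_left_of_le _ (-1) (fun x => neg_le_neg (hexp x))
      ((tendsto_sum_sq_sub p).const_mul_atTop hδpos)
  rw [driftLap_comp (φ := fun t => -Real.exp (-α * t) + δ * t)
    (φ' := fun t => α * Real.exp (-α * t) + δ) (φ'' := α * (Real.exp (-α * _) * -α)) hs
    (fun y => ((hder _).neg.add ((hasDerivAt_id _).const_mul δ)).congr_deriv (by ring))
    (((hder _).const_mul α).add_const δ)]
  have hL := driftLap_sum_sq_sub_le (f := f) p x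
  have hΓ := graphGradSq_sum_sq_sub_ge (f := f) p x
  have hq : 0 ≤ gradSq f x := gradSq_nonneg
  have hx0 := hs0 x
  rw [← sum_sq_sub_eq_dist_sq] at hx
  have hQx := hQ' x
  rw [← sum_sq_sub_eq_dist_sq] at hQx
  set s := ∑ k, (x k - p k) ^ 2
  set Γ := graphGradSq f (fun y => ∑ k, (y k - p k) ^ 2) x
  set L := driftLap f (fun y => ∑ k, (y k - p k) ^ 2) x
  have hE : 0 < Real.exp (-α * s) := Real.exp_pos _
  have hΓ0 : 0 ≤ Γ := le_trans (by positivity) hΓ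
  rcases le_or_gt s C with hsC | hsC
  · have hmono : Real.exp (-α * C) ≤ Real.exp (-α * s) := Real.exp_le_exp.2 (by nlinarith)
    have hαΓ : C ≤ α * Γ := by
      have h1 : 4 * r / (1 + Q) ≤ Γ := le_trans
        (div_le_div₀ (by positivity) (by linarith) (by linarith) (by linarith [hQx hsC])) hΓ
      calc C = α * (4 * r / (1 + Q)) := by rw [hα]; field_simp
        _ ≤ α * Γ := by gcongr
    have h1 : (α * Real.exp (-α * s) + δ) * L ≤ (α * Real.exp (-α * s) + δ) * (C / 2) := by
      gcongr
      linarith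
    have h2 : α * Real.exp (-α * s) * C ≤ α * Real.exp (-α * s) * (α * Γ) := by gcongr
    have h3 : δ < α * Real.exp (-α * s) := by
      have := mul_le_mul_of_nonneg_left hmono hαpos.le
      have := mul_pos hαpos (Real.exp_pos (-α * C))
      linarith
    nlinarith
  · have h1 : (α * Real.exp (-α * s) + δ) * L < 0 :=
      mul_neg_of_pos_of_neg (by positivity) (by linarith)
    have h2 : 0 ≤ α * Real.exp (-α * s) * (α * Γ) := by positivity
    linarith

/-- A nonnegative supersolution of the drift Laplacian on an entire graph is constant. -/
theorem eq_of_driftLap_nonpos {w : EuclideanSpace ℝ (Fin n) → ℝ} (hf : ContDiff ℝ (⊤ : ℕ∞) f)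
    (hw : ContDiff ℝ (⊤ : ℕ∞) w) (hw0 : ∀ x, 0 ≤ w x) (hL : ∀ x, driftLap f w x ≤ 0)
    (x y : EuclideanSpace ℝ (Fin n)) : w x = w y := by
  suffices h : ∀ p z, w p ≤ w z from le_antisymm (h x y) (h y x)
  intro p z
  by_contra! hlt
  obtain ⟨ρ, hρ, hball⟩ := Metric.eventually_nhds_iff.1
    (hw.continuous.continuousAt.eventually (lt_mem_nhds (show (w z + w p) / 2 < w p by linarith)))
  obtain ⟨ψ, hψ, hψ1, hψt, hψL⟩ := exists_barrier hf p (pow_pos hρ 2)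
  have hden : 0 < ψ z + 2 := by linarith [hψ1 z]
  obtain ⟨ε, hε⟩ : ∃ ε : ℝ, ε = (w p - w z) / 2 / (ψ z + 2) := ⟨_, rfl⟩
  have hεpos : 0 < ε := by
    rw [hε]
    exact div_pos (by linarith) hden
  have hεz : ε * (ψ z + 2) = (w p - w z) / 2 := by
    rw [hε]
    field_simp
  have hεψ : ContDiff ℝ (⊤ : ℕ∞) fun x => ε * ψ x := contDiff_const.mul hψ
  obtain ⟨m, hm⟩ := (hw.add hεψ).continuous.exists_forall_le
    (Filter.tendsto_atTop_add_left_of_le _ 0 hw0 (hψt.const_mul_atTop hεpos))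
  have hmz : w m + ε * ψ m ≤ w z + ε * ψ z := hm z
  rcases lt_or_ge (dist m p) ρ with hmp | hmp
  · have h1 := hball hmp
    nlinarith [hψ1 m]
  · have hmin : IsLocalMin (fun x => w x + ε * ψ x) m := Filter.Eventually.of_forall hm
    have h1 := hmin.driftLap_nonneg (f := f) (hw.add hεψ)
    rw [driftLap_add hw hεψ, driftLap_const_mul ε hψ] at h1
    have h2 := mul_neg_of_pos_of_neg hεpos (hψL m (pow_le_pow_left₀ hρ.le hmp 2))
    linarith [hL m]

theorem pd2_eq_zero_of_selfShrinker (hf : ContDiff ℝ (⊤ : ℕ∞) f)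
    (heq : ∀ x, ∑ i, ∑ j, gInv f i j x * pd2 f i j x
      = (1 / 2) * ((∑ i, x i * pd f i x) - f x))
    (i k : Fin n) (x : EuclideanSpace ℝ (Fin n)) : pd2 f i k x = 0 := by
  have hpos : ∀ y, 0 < 1 + gradSq f y := fun y => by
    have : 0 ≤ gradSq f y := gradSq_nonneg
    linarith
  have hconst : gradSq f = fun _ => gradSq f 0 := funext fun y => by
    have h := eq_of_driftLap_nonpos hf
      ((contDiff_const.add hf.gradSq).rpow_const_of_ne fun y => (hpos y).ne')
      (fun y => (Real.rpow_pos_of_pos (hpos y) _).le) (driftLap_rpow_gradSq_nonpos hf heq) y 0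
    have := Real.rpow_left_injOn (by norm_num : (-1 / 2 : ℝ) ≠ 0) (hpos y).le (hpos 0).le h
    linarith
  have hpd : ∀ (j : Fin n) y, pd (gradSq f) j y = 0 := fun j y => by
    rw [hconst]
    simp [pd]
  have hlap : driftLap f (gradSq f) x = 0 := by
    have hzero : ∀ j, pd (fun _ : EuclideanSpace ℝ (Fin n) => (0 : ℝ)) j x = 0 := fun j => by
      simp [pd]
    simp [driftLap, pd2, hpd, hzero]
  have hsum : ∑ k, graphGradSq f (fun y => pd f k y) x = 0 := by
    rw [driftLap_gradSq hf heq] at hlap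
    simpa [graphGradSq, hpd] using hlap
  have hle : ∀ k, (∑ i, pd2 f i k x ^ 2) / (1 + gradSq f x)
      ≤ graphGradSq f (fun y => pd f k y) x := fun k => sum_sq_div_le_graphGradSq
  have hnn : ∀ k, 0 ≤ ∑ i, pd2 f i k x ^ 2 := fun k => Finset.sum_nonneg fun _ _ => sq_nonneg _
  have hk := (Finset.sum_eq_zero_iff_of_nonneg fun k _ =>
    (div_nonneg (hnn k) (hpos x).le).trans (hle k)).1 hsum k (Finset.mem_univ k)
  have hk0 : ∑ i, pd2 f i k x ^ 2 = 0 := by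
    refine le_antisymm ?_ (hnn k)
    have := hle k
    rwa [hk, div_le_iff₀ (hpos x), zero_mul] at this
  exact pow_eq_zero_iff two_ne_zero |>.1
    ((Finset.sum_eq_zero_iff_of_nonneg fun _ _ => sq_nonneg _).1 hk0 i (Finset.mem_univ i))

end SelfShrinker

/-- Every smooth entire graphical self-shrinking hypersurface of the mean curvature flow
is a plane (through the origin). -/
theorem entire_graphical_self_shrinker_is_plane
    (n : ℕ) (hn : 1 ≤ n) (f : EuclideanSpace ℝ (Fin n) → ℝ)
    (hf : ContDiff ℝ (⊤ : ℕ∞) f)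
    (heq : ∀ x, ∑ i, ∑ j, gInv f i j x * pd2 f i j x
      = (1 / 2) * ((∑ i, x i * pd f i x) - f x)) :
    ∃ a : EuclideanSpace ℝ (Fin n), ∀ x, f x = ∑ i, a i * x i := by
  have hpd : ∀ k x, pd f k x = pd f k 0 := fun k x => by
    refine is_const_of_fderiv_eq_zero (𝕜 := ℝ) ((hf.pd k).differentiable (by simp)) (fun y => ?_)
      x 0
    ext v
    rw [fderiv_apply_eq_sum_pd]
    exact Finset.sum_eq_zero fun i _ =>
      mul_eq_zero_of_right _ (pd2_eq_zero_of_selfShrinker hf heq i k y)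
  refine ⟨WithLp.toLp 2 fun i => pd f i 0, fun x => ?_⟩
  have h := heq x
  simp only [pd2_eq_zero_of_selfShrinker hf heq, mul_zero, Finset.sum_const_zero, hpd] at h
  simp only [mul_comm (pd f _ 0)]
  linarith
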